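/- Let k ≥ 1 and let f : (ℝ^n)^k → ℝ be a smooth function whose support is contained in D^k = D × ⋯ × D (k factors). Then there exist a smooth function g : ℝ^n → ℝ with support contained in D and a smooth function h : (ℝ^n)^k → ℝ with support contained in D^k such that f(x₁, …, x_k) = g(x₁) · h(x₁, …, x_k) for all x₁, …, x_k ∈ ℝ^n. -/

import Mathlib

open Filter Topology Asymptotics

/-- A sequence decaying faster than every power of `2⁻¹` that dominates countably many
families of rapidly decaying quantities. -/
lemma exists_rapidly_decaying_dominating (A : ℕ → ℕ → ℝ) (hA : ∀ q N, 0 ≤ A q N) :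
    ∃ c : ℕ → ℝ, (∀ i, 0 < c i) ∧ (∀ N, ∃ B, ∀ i, c i * 2 ^ (i * N) ≤ B) ∧
      ∀ q, ∃ K, 0 < K ∧ ∀ (i : ℕ) (y : ℝ), (∀ N, y * 2 ^ (i * N) ≤ A q N) → y ≤ K * c i := by
  set D : ℕ → ℝ := fun N => 2 ^ (N * N) + ∑ q ∈ Finset.range (N + 1), A q N with hD
  have hsum : ∀ N, 0 ≤ ∑ q ∈ Finset.range (N + 1), A q N :=
    fun N => Finset.sum_nonneg fun q _ => hA q N
  have hD1 : ∀ N, 1 ≤ D N := fun N =>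
    le_add_of_le_of_nonneg (one_le_pow₀ one_le_two) (hsum N)
  have hbdd : ∀ i : ℕ, BddBelow (Set.range fun N => D N / 2 ^ (i * N)) := by
    refine fun i => ⟨0, ?_⟩
    rintro _ ⟨N, rfl⟩
    exact div_nonneg (zero_le_one.trans (hD1 N)) (by positivity)
  refine ⟨fun i => ⨅ N, D N / 2 ^ (i * N), fun i => ?_, fun N => ⟨D N, fun i => ?_⟩, fun q => ?_⟩
  · refine lt_of_lt_of_le (b := 1 / (2 : ℝ) ^ (i * i)) (by positivity) (le_ciInf fun N => ?_)
    rw [div_le_div_iff₀ (by positivity) (by positivity), one_mul]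
    calc (2 : ℝ) ^ (i * N) ≤ 2 ^ (N * N + i * i) :=
          pow_le_pow_right₀ one_le_two (by nlinarith [sq_nonneg ((N : ℤ) - i)])
      _ = 2 ^ (N * N) * 2 ^ (i * i) := pow_add _ _ _
      _ ≤ D N * 2 ^ (i * i) := by
          gcongr
          exact le_add_of_nonneg_right (hsum N)
  · rw [← le_div_iff₀ (by positivity)]
    exact ciInf_le (hbdd i) N
  · have hK : 0 ≤ ∑ N ∈ Finset.range q, A q N := Finset.sum_nonneg fun N _ => hA q N
    refine ⟨1 + ∑ N ∈ Finset.range q, A q N, by positivity, fun i y hy => ?_⟩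
    rw [← div_le_iff₀' (by positivity)]
    refine le_ciInf fun N => ?_
    rw [div_le_div_iff₀ (by positivity) (by positivity)]
    refine (hy N).trans ?_
    rcases lt_or_ge N q with hN | hN
    · have h1 : A q N ≤ ∑ N ∈ Finset.range q, A q N :=
        Finset.single_le_sum (f := fun N => A q N) (fun N _ => hA q N) (Finset.mem_range.2 hN)
      nlinarith [hD1 N]
    · have h1 : A q N ≤ D N := by
        have := Finset.single_le_sum (f := fun q => A q N) (fun q _ => hA q N)
          (Finset.mem_range.2 (Nat.lt_succ_of_le hN))
        have h2 : (0 : ℝ) ≤ 2 ^ (N * N) := by positivity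
        simp only [hD]
        linarith
      nlinarith [hD1 N]

/-- All derivatives of the standard smooth transition function are bounded. -/
lemma exists_bound_iteratedDeriv_smoothTransition (j : ℕ) :
    ∃ C, ∀ t, ‖iteratedDeriv j Real.smoothTransition t‖ ≤ C := by
  have hcont : Continuous (iteratedDeriv j Real.smoothTransition) :=
    (Real.smoothTransition.contDiff (n := ⊤)).continuous_iteratedDeriv j (mod_cast le_top)
  obtain ⟨C, hC⟩ := isCompact_Icc.exists_bound_of_continuousOn
    (s := Set.Icc (0 : ℝ) 1) hcont.continuousOn
  refine ⟨max C 1, fun t => ?_⟩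
  rcases lt_or_ge t 0 with ht | ht
  · have : Real.smoothTransition =ᶠ[𝓝 t] fun _ => (0 : ℝ) := by
      filter_upwards [Iio_mem_nhds ht] with s hs
      exact Real.smoothTransition.zero_of_nonpos (Set.mem_Iio.1 hs).le
    rw [this.iteratedDeriv_eq, iteratedDeriv_const]
    simp
  rcases lt_or_ge 1 t with ht' | ht'
  · have : Real.smoothTransition =ᶠ[𝓝 t] fun _ => (1 : ℝ) := by
      filter_upwards [Ioi_mem_nhds ht'] with s hs
      exact Real.smoothTransition.one_of_one_le (Set.mem_Ioi.1 hs).le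
    rw [this.iteratedDeriv_eq, iteratedDeriv_const]
    split_ifs <;> simp
  · exact (hC t ⟨ht, ht'⟩).trans (le_max_left _ _)

/-- A smooth function on the line, positive exactly on the positive half-line, that dominates
countably many families of quantities vanishing to infinite order at `0`. -/
lemma exists_smooth_dominating (A : ℕ → ℕ → ℝ) (hA : ∀ q N, 0 ≤ A q N) :
    ∃ φ : ℝ → ℝ, ContDiff ℝ (⊤ : ℕ∞) φ ∧ (∀ t ≤ 0, φ t = 0) ∧ (∀ t, 0 < t → 0 < φ t) ∧
      ∀ q, ∃ K, 0 < K ∧ ∀ (i : ℕ) (t y : ℝ), 1 ≤ 2 ^ i * t →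
        (∀ N, y * 2 ^ (i * N) ≤ A q N) → y ≤ K * φ t := by
  obtain ⟨c, hc, hcB, hcK⟩ := exists_rapidly_decaying_dominating A hA
  choose B hB using hcB
  choose M hM using exists_bound_iteratedDeriv_smoothTransition
  have hM0 : ∀ j, 0 ≤ M j := fun j => (norm_nonneg _).trans (hM j 0)
  set u : ℕ → ℝ → ℝ := fun i t => c i * Real.smoothTransition (2 ^ i * t) with hu
  have hu0 : ∀ i t, 0 ≤ u i t := fun i t =>
    mul_nonneg (hc i).le (Real.smoothTransition.nonneg _)
  have hder : ∀ (j i : ℕ) (t : ℝ), ‖iteratedFDeriv ℝ j (u i) t‖ ≤ B (j + 1) * M j * (1 / 2) ^ i := by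
    intro j i t
    have hS : ContDiff ℝ j Real.smoothTransition :=
      Real.smoothTransition.contDiff (n := (j : ℕ∞))
    rw [norm_iteratedFDeriv_eq_norm_iteratedDeriv, hu]
    simp only
    rw [iteratedDeriv_const_mul_field, iteratedDeriv_comp_const_mul hS, norm_mul, norm_mul,
      norm_pow, norm_pow, Real.norm_of_nonneg (hc i).le, Real.norm_two]
    have h1 : c i * (2 ^ i) ^ j ≤ B (j + 1) * (1 / 2) ^ i := by
      rw [one_div, inv_pow, ← div_eq_mul_inv, le_div_iff₀ (by positivity), mul_assoc, ← pow_succ,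
        ← pow_mul]
      exact hB (j + 1) i
    calc _ = (c i * (2 ^ i) ^ j) * ‖iteratedDeriv j Real.smoothTransition (2 ^ i * t)‖ := by ring
      _ ≤ (B (j + 1) * (1 / 2) ^ i) * M j :=
          mul_le_mul h1 (hM j _) (norm_nonneg _)
            ((mul_nonneg (hc i).le (by positivity)).trans h1)
      _ = _ := by ring
  have hsummable : ∀ j, Summable fun i : ℕ => B (j + 1) * M j * (1 / 2 : ℝ) ^ i := fun j =>
    summable_geometric_two.mul_left _
  have husum : ∀ t, Summable fun i => u i t := fun t =>
    Summable.of_norm_bounded (hsummable 0) fun i => by simpa using hder 0 i t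
  refine ⟨fun t => ∑' i, u i t, ?_, fun t ht => ?_, fun t ht => ?_, fun q => ?_⟩
  · refine contDiff_tsum (v := fun j i => B (j + 1) * M j * (1 / 2 : ℝ) ^ i) (fun i => ?_)
      (fun j _ => hsummable j) fun j i t _ => hder j i t
    exact contDiff_const.mul (Real.smoothTransition.contDiff.comp (contDiff_const.mul contDiff_id))
  · have : ∀ i, u i t = 0 := fun i => by
      simp only [hu]
      rw [Real.smoothTransition.zero_of_nonpos (mul_nonpos_of_nonneg_of_nonpos (by positivity) ht),
        mul_zero]
    simp [this]
  · exact (husum t).tsum_pos (hu0 · t) 0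
      (mul_pos (hc 0) (Real.smoothTransition.pos_of_pos (by positivity)))
  · obtain ⟨K, hK0, hK⟩ := hcK q
    refine ⟨K, hK0, fun i t y ht hy => (hK i y hy).trans ?_⟩
    gcongr
    have h1 : u i t = c i := by simp [hu, Real.smoothTransition.one_of_one_le ht]
    exact h1.symm.le.trans ((husum t).le_tsum i fun k _ => hu0 k t)

/-- A smooth function, all of whose derivatives are locally dominated by every power of `g`,
stays smooth after division by any power of `g`. -/
lemma contDiff_inv_pow_smul {E : Type} [NormedAddCommGroup E] [NormedSpace ℝ E] {g : E → ℝ}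
    (hg : ContDiff ℝ (⊤ : ℕ∞) g) (n : ℕ) :
    ∀ {V : Type} [NormedAddCommGroup V] [NormedSpace ℝ V] {F : E → V} (p : ℕ),
      ContDiff ℝ (⊤ : ℕ∞) F →
      (∀ (x : E) (j m : ℕ), iteratedFDeriv ℝ j F =O[𝓝 x] fun y => g y ^ m) →
      ContDiff ℝ n fun x => (g x)⁻¹ ^ p • F x := by
  have hgd : ∀ x, HasFDerivAt g (fderiv ℝ g x) x := fun x =>
    (hg.differentiable (by simp) x).hasFDerivAt
  have hzero : ∀ {V : Type} [NormedAddCommGroup V] [NormedSpace ℝ V] {F : E → V},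
      (∀ (x : E) (j m : ℕ), iteratedFDeriv ℝ j F =O[𝓝 x] fun y => g y ^ m) →
      (∀ x, g x = 0 → F x = 0) ∧ ∀ x m, F =O[𝓝 x] fun y => g y ^ m := by
    intro V _ _ F hF
    have h0 : ∀ x m, F =O[𝓝 x] fun y => g y ^ m := fun x m => by
      simpa using (hF x 0 m).norm_left
    refine ⟨fun x hx => ?_, h0⟩
    obtain ⟨C, hC⟩ := (h0 x 1).bound
    simpa [hx] using hC.self_of_nhds
  have hderiv : ∀ {V : Type} [NormedAddCommGroup V] [NormedSpace ℝ V] {F : E → V} (p : ℕ),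
      ContDiff ℝ (⊤ : ℕ∞) F →
      (∀ (x : E) (j m : ℕ), iteratedFDeriv ℝ j F =O[𝓝 x] fun y => g y ^ m) →
      ∀ x, HasFDerivAt (fun x => (g x)⁻¹ ^ p • F x)
        ((g x)⁻¹ ^ p • fderiv ℝ F x -
          (p : ℝ) • (g x)⁻¹ ^ (p + 1) • (fderiv ℝ g x).smulRight (F x)) x := by
    intro V _ _ F p hF hO x
    obtain ⟨hF0, hFO⟩ := hzero hO
    rcases eq_or_ne (g x) 0 with hx | hx
    · have hF' : fderiv ℝ F x = 0 := by
        obtain ⟨C, hC⟩ := (hO x 1 1).bound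
        have := hC.self_of_nhds
        rw [← norm_iteratedFDeriv_fderiv (n := 0), norm_iteratedFDeriv_zero] at this
        simpa [hx] using this
      rw [hF', hF0 x hx]
      have hO2 : (fun y => (g y)⁻¹ ^ p • F y) =O[𝓝 x] fun y => ‖y - x‖ ^ 2 := by
        have h1 : (fun y => (g y)⁻¹ ^ p • F y) =O[𝓝 x] fun y => g y ^ 2 := by
          obtain ⟨C, hC⟩ := (hFO x (p + 2)).bound
          refine IsBigO.of_bound C ?_
          filter_upwards [hC] with y hy
          rcases eq_or_ne (g y) 0 with hgy | hgy
          · simp [hF0 y hgy, hgy]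
          · rw [norm_smul, inv_pow, norm_inv, inv_mul_le_iff₀ (norm_pos_iff.2 (pow_ne_zero _ hgy))]
            refine hy.trans_eq ?_
            rw [pow_add, norm_mul]
            ring
        have h2 : g =O[𝓝 x] fun y => y - x := by
          simpa [hx] using (hgd x).isBigO_sub
        exact h1.trans (h2.norm_right.pow 2)
      simpa using hO2.hasFDerivAt one_lt_two
    · have h1 : HasFDerivAt (fun y => (g y)⁻¹ ^ p)
          ((-(p : ℝ) * (g x)⁻¹ ^ (p + 1)) • fderiv ℝ g x) x := by
        refine (((hasDerivAt_inv hx).fun_pow p).comp_hasFDerivAt x (hgd x)).congr_fderiv ?_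
        congr 1
        rcases p with _ | p
        · simp
        · rw [Nat.add_sub_cancel]
          ring
      refine (h1.smul (hF.differentiable (by simp) x).hasFDerivAt).congr_fderiv ?_
      ext v
      simp only [sub_apply, add_apply, smul_apply, ContinuousLinearMap.smulRight_apply, smul_eq_mul]
      module
  induction n with
  | zero =>
    intro V _ _ F p hF hO
    exact contDiff_zero.2 (continuous_iff_continuousAt.2 fun x => (hderiv p hF hO x).continuousAt)
  | succ n ih =>
    intro V _ _ F p hF hO
    refine contDiff_succ_iff_hasFDerivAt.2 ⟨_, ?_, hderiv p hF hO⟩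
    have hF' : ContDiff ℝ (⊤ : ℕ∞) (fderiv ℝ F) := hF.fderiv_right (by simp)
    have hg' : ContDiff ℝ (⊤ : ℕ∞) (fderiv ℝ g) := hg.fderiv_right (by simp)
    refine (ih p hF' fun x j m => ?_).sub (.const_smul (p : ℝ)
      (ih (p + 1) (hg'.smulRight hF) fun x j m => ?_))
    · refine IsBigO.of_norm_left ?_
      simp_rw [norm_iteratedFDeriv_fderiv]
      exact (hO x (j + 1) m).norm_left
    · refine (IsBigO.of_norm_le fun y =>
        (ContinuousLinearMap.smulRightL ℝ E V).norm_iteratedFDeriv_le_of_bilinear hg' hF y (n := j)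
          (mod_cast le_top)).trans ?_
      refine .const_mul_left (.fun_sum fun i _ => ?_) _
      have h1 : iteratedFDeriv ℝ i (fderiv ℝ g) =O[𝓝 x] fun _ => (1 : ℝ) :=
        (hg'.continuous_iteratedFDeriv (mod_cast le_top)).continuousAt.isBigO_one ℝ
      simpa using (h1.norm_left.const_mul_left _).mul (hO x (j - i) m).norm_left

/-- A continuous function vanishing where one variable has norm `> 1` also vanishes where it has
norm `≥ 1`. -/
lemma eq_zero_of_one_le_norm_of_one_lt_norm {ι W V : Type*} [NormedAddCommGroup W]
    [NormedSpace ℝ W] [NormedAddCommGroup V] {F : (ι → W) → V} (i : ι) (hF : Continuous F)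
    (h0 : ∀ x, 1 < ‖x i‖ → F x = 0) (x : ι → W) (hx : 1 ≤ ‖x i‖) : F x = 0 := by
  have hcont : Continuous fun s : ℝ => F (s • x) := hF.comp (continuous_id.smul continuous_const)
  have hlim : Tendsto (fun s : ℝ => F (s • x)) (𝓝[>] 1) (𝓝 (F x)) := by
    simpa using (hcont.tendsto 1).mono_left nhdsWithin_le_nhds
  refine tendsto_nhds_unique hlim (tendsto_const_nhds.congr' ?_)
  filter_upwards [self_mem_nhdsWithin] with s hs
  have hs' : 1 < s := hs
  refine (h0 _ ?_).symm
  rw [Pi.smul_apply, norm_smul, Real.norm_of_nonneg (by linarith)]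
  nlinarith

/-- A smooth function supported in a product of unit balls vanishes to infinite order as one of
the variables approaches the unit sphere. -/
lemma exists_norm_le_mul_pow {ι W : Type} [Fintype ι] [NormedAddCommGroup W]
    [NormedSpace ℝ W] (i : ι) (N : ℕ) :
    ∀ {V : Type} [NormedAddCommGroup V] [NormedSpace ℝ V] {F : (ι → W) → V},
      ContDiff ℝ (⊤ : ℕ∞) F → HasCompactSupport F → (∀ x, 1 ≤ ‖x i‖ → F x = 0) →
      ∃ C, 0 ≤ C ∧ ∀ x r, 0 ≤ r → 1 - r ≤ ‖x i‖ → ‖F x‖ ≤ C * r ^ N := by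
  classical
  induction N with
  | zero =>
    intro V _ _ F hF hc _
    obtain ⟨C, hC⟩ := hF.continuous.bounded_above_of_compact_support hc
    exact ⟨C, (norm_nonneg _).trans (hC 0), fun x r _ _ => by simpa using hC x⟩
  | succ N ih =>
    intro V _ _ F hF hc h0
    obtain ⟨C, hC0, hC⟩ := ih (hF.fderiv_right (m := (⊤ : ℕ∞)) (by simp)) (hc.fderiv ℝ)
      (eq_zero_of_one_le_norm_of_one_lt_norm i (hF.continuous_fderiv (by simp)) fun x hx => by
        have : F =ᶠ[𝓝 x] fun _ => 0 := by
          filter_upwards [(isOpen_lt continuous_const (continuous_apply i).norm).mem_nhds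
            (show x ∈ {y : ι → W | 1 < ‖y i‖} from hx)]
            with y hy using h0 y (le_of_lt hy)
        rw [this.fderiv_eq, fderiv_fun_const]
        rfl)
    obtain ⟨C', hC'⟩ := hF.continuous.bounded_above_of_compact_support hc
    have hC'0 : 0 ≤ C' := (norm_nonneg _).trans (hC' 0)
    refine ⟨max C C', le_max_of_le_left hC0, fun x r hr hx => ?_⟩
    rcases le_or_gt 1 ‖x i‖ with h1 | h1
    · rw [h0 x h1, norm_zero]
      positivity
    rcases eq_or_ne (x i) 0 with hxi | hxi
    · rw [hxi, norm_zero] at hx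
      calc ‖F x‖ ≤ C' * 1 := by simpa using hC' x
        _ ≤ max C C' * r ^ (N + 1) := by
          gcongr
          · exact le_max_right _ _
          · exact one_le_pow₀ (by linarith)
    have hpos : 0 < ‖x i‖ := norm_pos_iff.2 hxi
    have hinv : 0 ≤ ‖x i‖⁻¹ - 1 := sub_nonneg.2 (one_le_inv_iff₀.2 ⟨hpos, h1.le⟩)
    set v : ι → W := Pi.single i ((‖x i‖⁻¹ - 1) • x i) with hv
    have hvnorm : ‖v‖ = 1 - ‖x i‖ := by
      rw [hv, Pi.norm_single, norm_smul, Real.norm_of_nonneg hinv, sub_mul,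
        inv_mul_cancel₀ hpos.ne', one_mul]
    have hray : ∀ s : ℝ, 0 ≤ s → ‖(x + s • v) i‖ = ‖x i‖ + s * (1 - ‖x i‖) := by
      intro s hs
      have : (x + s • v) i = (1 + s * (‖x i‖⁻¹ - 1)) • x i := by
        simp [hv, add_smul, mul_smul]
      rw [this, norm_smul, Real.norm_of_nonneg (by positivity)]
      field_simp
    have hend : F (x + v) = 0 := h0 _ (by simpa using (hray 1 zero_le_one).ge)
    have hmv := (convex_segment x (x + v)).norm_image_sub_le_of_norm_fderiv_le (𝕜 := ℝ) (f := F)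
      (C := C * r ^ N) (fun y _ => hF.differentiable (by simp) y) (fun y hy => ?_)
      (right_mem_segment ℝ x (x + v)) (left_mem_segment ℝ x (x + v))
    · rw [hend, sub_zero, sub_add_cancel_left, norm_neg, hvnorm] at hmv
      calc ‖F x‖ ≤ C * r ^ N * (1 - ‖x i‖) := hmv
        _ ≤ max C C' * r ^ N * r := by
          gcongr
          · exact le_max_left _ _
          · linarith
        _ = max C C' * r ^ (N + 1) := by ring
    · rw [segment_eq_image'] at hy
      obtain ⟨s, hs, rfl⟩ := hy
      refine hC _ r hr ?_
      simp only [add_sub_cancel_left]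
      rw [hray s hs.1]
      nlinarith [hs.1]

/-- Let `k ≥ 1` and `f : (ℝⁿ)^k → ℝ` be smooth with support contained in `D^k`,
where `D ⊆ ℝⁿ` is the closed unit ball.  Then there exist a smooth `g : ℝⁿ → ℝ`
supported in `D` and a smooth `h : (ℝⁿ)^k → ℝ` supported in `D^k` with
`f(x₁,…,x_k) = g(x₁) · h(x₁,…,x_k)` for all `x₁,…,x_k`. -/
theorem factorization_of_compactly_supported_smooth
    (n k : ℕ) (hk : 1 ≤ k)
    (f : (Fin k → EuclideanSpace ℝ (Fin n)) → ℝ)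
    (hf : ContDiff ℝ (⊤ : ℕ∞) f)
    (hsupp : tsupport f ⊆
      {x | ∀ i, x i ∈ Metric.closedBall (0 : EuclideanSpace ℝ (Fin n)) 1}) :
    ∃ (g : EuclideanSpace ℝ (Fin n) → ℝ)
      (h : (Fin k → EuclideanSpace ℝ (Fin n)) → ℝ),
      ContDiff ℝ (⊤ : ℕ∞) g ∧
      tsupport g ⊆ Metric.closedBall (0 : EuclideanSpace ℝ (Fin n)) 1 ∧
      ContDiff ℝ (⊤ : ℕ∞) h ∧
      tsupport h ⊆ {x | ∀ i, x i ∈ Metric.closedBall (0 : EuclideanSpace ℝ (Fin n)) 1} ∧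
      ∀ x : Fin k → EuclideanSpace ℝ (Fin n), f x = g (x ⟨0, hk⟩) * h x := by
  set i₀ : Fin k := ⟨0, hk⟩
  have hcompact : HasCompactSupport f := by
    refine (isCompact_univ_pi fun _ : Fin k =>
      isCompact_closedBall (0 : EuclideanSpace ℝ (Fin n)) 1).of_isClosed_subset
      (isClosed_tsupport f) fun x hx i _ => hsupp hx i
  have hzero : ∀ (j : ℕ) (x : Fin k → EuclideanSpace ℝ (Fin n)), 1 ≤ ‖x i₀‖ →
      iteratedFDeriv ℝ j f x = 0 := fun j =>
    eq_zero_of_one_le_norm_of_one_lt_norm i₀ (hf.continuous_iteratedFDeriv (mod_cast le_top))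
      fun x hx => image_eq_zero_of_notMem_tsupport fun hx' =>
        hx.not_ge (by simpa using hsupp (tsupport_iteratedFDeriv_subset j hx') i₀)
  have hflat : ∀ j N : ℕ, ∃ C, 0 ≤ C ∧ ∀ (x : Fin k → EuclideanSpace ℝ (Fin n)) r, 0 ≤ r →
      1 - r ≤ ‖x i₀‖ → ‖iteratedFDeriv ℝ j f x‖ ≤ C * r ^ N := fun j N =>
    exists_norm_le_mul_pow i₀ N (hf.iteratedFDeriv_right (m := (⊤ : ℕ∞)) (mod_cast le_top))
      (hcompact.iteratedFDeriv j) (hzero j)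
  choose C hC0 hC using hflat
  have hroot : ∀ (y : ℝ) (m : ℕ), 0 ≤ y → ∃ a, 0 ≤ a ∧ a ^ (m + 1) = y := fun y m hy =>
    ⟨y ^ (((m + 1 : ℕ) : ℝ)⁻¹), by positivity, Real.rpow_inv_natCast_pow hy m.succ_ne_zero⟩
  choose a ha0 ha using fun j m N => hroot (C j (N * (m + 1))) m (hC0 j _)
  obtain ⟨φ, hφ, hφ0, hφpos, hφK⟩ := exists_smooth_dominating
    (fun q N => a q.unpair.1 q.unpair.2 N * 2 ^ N) fun q N => mul_nonneg (ha0 _ _ _) (by positivity)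
  set g : EuclideanSpace ℝ (Fin n) → ℝ := fun z => φ (1 - ‖z‖ ^ 2)
  have hgsmooth : ContDiff ℝ (⊤ : ℕ∞) g := hφ.comp (contDiff_const.sub (contDiff_norm_sq ℝ))
  have hg0 : ∀ z, 1 ≤ ‖z‖ → g z = 0 := fun z hz => hφ0 _ (by nlinarith)
  have hgpos : ∀ z, ‖z‖ < 1 → 0 < g z := fun z hz => hφpos _ (by nlinarith [norm_nonneg z])
  have hbound : ∀ j m : ℕ, ∃ K, ∀ x : Fin k → EuclideanSpace ℝ (Fin n),
      ‖iteratedFDeriv ℝ j f x‖ ≤ K * g (x i₀) ^ (m + 1) := by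
    intro j m
    obtain ⟨K, hK0, hK⟩ := hφK (Nat.pair j m)
    refine ⟨K ^ (m + 1), fun x => ?_⟩
    rcases le_or_gt 1 ‖x i₀‖ with hx | hx
    · rw [hzero j x hx, norm_zero, hg0 _ hx]
      simp
    obtain ⟨y, hy0, hy⟩ := hroot ‖iteratedFDeriv ℝ j f x‖ m (norm_nonneg _)
    have ht0 : 0 < 1 - ‖x i₀‖ ^ 2 := by nlinarith [norm_nonneg (x i₀)]
    have ht1 : 1 - ‖x i₀‖ ^ 2 ≤ 1 := by nlinarith
    obtain ⟨i, hi, hi'⟩ := exists_nat_pow_near_of_lt_one ht0 ht1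
      (y := (1 / 2 : ℝ)) (by norm_num) (by norm_num)
    rw [← hy, ← mul_pow]
    refine pow_le_pow_left₀ hy0 (hK (i + 1) _ y ?_ fun N => ?_) _
    · rw [one_div, inv_pow, inv_lt_iff_one_lt_mul₀' (by positivity)] at hi
      exact hi.le
    · simp only [Nat.unpair_pair]
      have hyN : y ≤ a j m N * ((1 / 2) ^ i) ^ N := by
        refine (pow_le_pow_iff_left₀ hy0 (mul_nonneg (ha0 _ _ _) (by positivity))
          m.succ_ne_zero).1 ?_
        rw [hy, mul_pow, ha, ← pow_mul _ N]
        exact hC j _ x _ (by positivity) (by nlinarith [norm_nonneg (x i₀)])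
      calc y * 2 ^ ((i + 1) * N) ≤ a j m N * ((1 / 2) ^ i) ^ N * 2 ^ ((i + 1) * N) := by gcongr
        _ = a j m N * 2 ^ N := by
          rw [pow_mul 2, mul_assoc, ← mul_pow, pow_succ, ← mul_assoc, ← mul_pow]
          norm_num
  have hG : ContDiff ℝ (⊤ : ℕ∞) fun x : Fin k → EuclideanSpace ℝ (Fin n) => g (x i₀) :=
    hgsmooth.comp (contDiff_apply ℝ _ i₀)
  have hO : ∀ (x : Fin k → EuclideanSpace ℝ (Fin n)) (j m : ℕ),
      iteratedFDeriv ℝ j f =O[𝓝 x] fun y => g (y i₀) ^ m := by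
    intro x j m
    rcases m with _ | m
    · simpa using ((hf.continuous_iteratedFDeriv (m := j) (mod_cast le_top)).tendsto x).isBigO_one ℝ
    · obtain ⟨K, hK⟩ := hbound j m
      refine IsBigO.of_bound K (.of_forall fun y => (hK y).trans_eq ?_)
      rw [Real.norm_of_nonneg]
      refine pow_nonneg ?_ _
      rcases le_or_gt 1 ‖y i₀‖ with hy | hy
      · exact (hg0 _ hy).ge
      · exact (hgpos _ hy).le
  refine ⟨g, fun x => (g (x i₀))⁻¹ ^ 1 • f x, hgsmooth, ?_, contDiff_infty.2 fun N =>
    contDiff_inv_pow_smul hG N 1 hf hO, ?_, fun x => ?_⟩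
  · refine closure_minimal (fun z hz => ?_) Metric.isClosed_closedBall
    rw [mem_closedBall_zero_iff]
    exact le_of_not_ge fun hz' => hz (hg0 z hz')
  · refine (closure_mono fun x hx => ?_).trans hsupp
    rw [Function.mem_support] at hx ⊢
    exact fun hfx => hx (by rw [hfx, smul_zero])
  · rcases le_or_gt 1 ‖x i₀‖ with hx | hx
    · have := hzero 0 x hx
      rw [← norm_eq_zero, norm_iteratedFDeriv_zero, norm_eq_zero] at this
      simp [this]
    · simp only [pow_one]
      rw [smul_eq_mul, mul_inv_cancel_left₀ (hgpos _ hx).ne']
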